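/- L_α is a Fourier multiplier of order max{0, α−1}: Let α ∈ (0,1) ∪ (1,2). The function ξ ↦ L_α(ξ) is infinitely differentiable on [1/2, ∞), and for every β ∈ ℕ there exists a constant C_β > 0 such that |d^β/dξ^β L_α(ξ)| ≤ C_β · ξ^{max{0, α−1} − β} for all ξ ≥ 1/2. (Since L_α is even, this expresses that L_α is a Fourier multiplier of order max{0, α−1}.) -/

import Mathlib

/-- The constant `c_α = Γ(α/2)/(2^{1-α} Γ(1-α/2))`. -/
noncomputable def cc (α : ℝ) : ℝ :=
  Real.Gamma (α / 2) / (2 ^ (1 - α) * Real.Gamma (1 - α / 2))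

/-- The constant `V_α`. -/
noncomputable def VV (α : ℝ) : ℝ :=
  cc α / (2 * (1 - α / 2)) * (1 / (1 - α)) *
    (Real.Gamma (2 - α) / (Real.Gamma (1 - α / 2)) ^ 2)

/-- The constant `A_α`. -/
noncomputable def AA (α : ℝ) : ℝ :=
  cc α / (2 * (1 - α / 2)) * (1 / (1 - α)) *
    (Real.Gamma (3 - α) / (Real.Gamma (1 - α / 2) * Real.Gamma (α / 2)))

/-- The symbol `L_α(ξ) = V_α - A_α Γ(α/2+|ξ|)/Γ(1-α/2+|ξ|)`. -/
noncomputable def LL (α ξ : ℝ) : ℝ :=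
  VV α - AA α * (Real.Gamma (α / 2 + |ξ|) / Real.Gamma (1 - α / 2 + |ξ|))

/-- Domination of the complex Beta integral by its real counterpart. -/
theorem norm_Gamma_ratio_le (u : ℂ) (s : ℝ) (hu : 0 < u.re) (hs : 0 < s) :
    ‖Complex.Gamma u / Complex.Gamma (u + s)‖ ≤ Real.Gamma u.re / Real.Gamma (u.re + s) := by
  have hs' : 0 < (s : ℂ).re := by simpa using hs
  have hG : Complex.Gamma s ≠ 0 := Complex.Gamma_ne_zero_of_re_pos hs'
  have hGr : 0 < Real.Gamma s := Real.Gamma_pos_of_pos hs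
  have hne : ∀ w : ℂ, 0 < w.re → Complex.Gamma w / Complex.Gamma (w + s)
      = Complex.betaIntegral w s / Complex.Gamma s := by
    intro w hw
    have h1 : Complex.Gamma (w + s) ≠ 0 :=
      Complex.Gamma_ne_zero_of_re_pos (by simp; linarith)
    rw [div_eq_div_iff h1 hG, Complex.Gamma_mul_Gamma_eq_betaIntegral hw hs', mul_comm]
  have hreal : Complex.betaIntegral (u.re : ℂ) s
      = ((∫ x in (0:ℝ)..1, x ^ (u.re - 1) * (1 - x) ^ (s - 1) : ℝ) : ℂ) := by
    rw [Complex.betaIntegral, ← intervalIntegral.integral_ofReal]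
    apply intervalIntegral.integral_congr
    intro x hx
    rw [Set.uIcc_of_le zero_le_one] at hx
    have h2 : 0 ≤ 1 - x := by linarith [hx.2]
    simp only []
    rw [Complex.ofReal_mul, Complex.ofReal_cpow hx.1, Complex.ofReal_cpow h2]
    push_cast
    rfl
  have hle : ‖Complex.betaIntegral u s‖
      ≤ ∫ x in (0:ℝ)..1, x ^ (u.re - 1) * (1 - x) ^ (s - 1) := by
    rw [Complex.betaIntegral]
    refine (intervalIntegral.norm_integral_le_integral_norm zero_le_one).trans (le_of_eq ?_)
    apply intervalIntegral.integral_congr_ae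
    have h1 : ∀ᵐ x : ℝ, x ≠ 1 := by
      simp [MeasureTheory.ae_iff]
    filter_upwards [h1] with x hx1 hx
    rw [Set.uIoc_of_le zero_le_one] at hx
    have h2 : 0 < 1 - x := by
      have := lt_of_le_of_ne hx.2 hx1
      linarith
    have h3 : (1 - (x : ℂ)) = ((1 - x : ℝ) : ℂ) := by push_cast; rfl
    rw [norm_mul, h3, Complex.norm_cpow_eq_rpow_re_of_pos hx.1,
      Complex.norm_cpow_eq_rpow_re_of_pos h2]
    simp
  have hR : Real.Gamma u.re / Real.Gamma (u.re + s)
      = (∫ x in (0:ℝ)..1, x ^ (u.re - 1) * (1 - x) ^ (s - 1)) / Real.Gamma s := by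
    have := hne (u.re : ℂ) (by simpa using hu)
    rw [hreal, ← Complex.ofReal_add, Complex.Gamma_ofReal, Complex.Gamma_ofReal,
      Complex.Gamma_ofReal] at this
    exact_mod_cast this
  rw [hne u hu, hR, norm_div, Complex.Gamma_ofReal, Complex.norm_real, Real.norm_eq_abs,
    abs_of_pos hGr]
  gcongr

theorem real_Gamma_ratio_le (b y s : ℝ) (hb : 0 < b) (hby : b ≤ y) (hs : 0 < s) (hs1 : s < 1) :
    Real.Gamma y / Real.Gamma (y + s) ≤ (1 + 1 / b) * y ^ (-s) := by
  have hy : 0 < y := hb.trans_le hby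
  have hys : 0 < y + s := by linarith
  have hG := Real.Gamma_pos_of_pos hys
  have h := Real.Gamma_mul_add_mul_le_rpow_Gamma_mul_rpow_Gamma (s := y + s) (t := y + s + 1)
    (a := s) (b := 1 - s) hys (by linarith) hs (by linarith) (by ring)
  have e : s * (y + s) + (1 - s) * (y + s + 1) = y + 1 := by ring
  rw [e, Real.Gamma_add_one hy.ne', Real.Gamma_add_one hys.ne',
    Real.mul_rpow hys.le hG.le, mul_left_comm, ← Real.rpow_add hG] at h
  have e2 : s + (1 - s) = 1 := by ring
  rw [e2, Real.rpow_one] at h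
  have h5 : (y + s) ^ (1 - s) ≤ (1 + 1 / b) * y ^ (1 - s) := by
    have h6 : y + s ≤ (1 + 1 / b) * y := by
      have : 1 ≤ 1 / b * y := by
        rw [one_div, inv_mul_eq_div, le_div_iff₀ hb]; linarith
      nlinarith
    have hb1 : 1 ≤ 1 + 1 / b := by
      have : 0 < 1 / b := by positivity
      linarith
    calc (y + s) ^ (1 - s) ≤ ((1 + 1 / b) * y) ^ (1 - s) :=
          Real.rpow_le_rpow hys.le h6 (by linarith)
      _ = (1 + 1 / b) ^ (1 - s) * y ^ (1 - s) := Real.mul_rpow (by positivity) hy.le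
      _ ≤ (1 + 1 / b) ^ (1 : ℝ) * y ^ (1 - s) := by
          gcongr
          linarith
      _ = _ := by rw [Real.rpow_one]
  rw [div_le_iff₀ hG]
  have e3 : y ^ (1 - s) = y * y ^ (-s) := by
    rw [sub_eq_add_neg, Real.rpow_add hy, Real.rpow_one]
  rw [e3] at h5
  refine le_of_mul_le_mul_left ?_ hy
  calc y * Real.Gamma y ≤ _ := h
    _ ≤ ((1 + 1 / b) * (y * y ^ (-s))) * Real.Gamma (y + s) := by gcongr
    _ = _ := by ring

/-- Bound of the Gamma quotient in discs around the positive half-axis. -/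
theorem G_bound (α : ℝ) (hα : α ∈ Set.Ioo (0 : ℝ) 1 ∪ Set.Ioo (1 : ℝ) 2) :
    ∃ K : ℝ, 0 < K ∧ ∀ ξ : ℝ, 1 / 2 ≤ ξ → ∀ z : ℂ, ‖z - ξ‖ ≤ ξ / 2 →
      ‖Complex.Gamma ((α / 2 : ℝ) + z) / Complex.Gamma ((1 - α / 2 : ℝ) + z)‖
        ≤ K * ξ ^ (max 0 (α - 1)) := by
  have hre : ∀ ξ : ℝ, ∀ z : ℂ, ‖z - ξ‖ ≤ ξ / 2 → ξ / 2 ≤ z.re := by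
    intro ξ z h
    have := (abs_le.1 ((Complex.abs_re_le_norm (z - ξ)).trans h)).1
    simp at this
    linarith
  rcases hα with ⟨h0, h1⟩ | ⟨h1, h2⟩
  · refine ⟨(1 + 1 / (α / 2)) * (α / 2) ^ (-(1 - α)), by positivity, fun ξ hξ z hz => ?_⟩
    have hx := hre ξ z hz
    rw [max_eq_left (by linarith), Real.rpow_zero, mul_one]
    have e : ((1 - α / 2 : ℝ) : ℂ) + z = ((α / 2 : ℝ) + z) + ((1 - α : ℝ) : ℂ) := by
      push_cast; ring
    have er : (((α / 2 : ℝ) : ℂ) + z).re = α / 2 + z.re := by simp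
    rw [e]
    refine (norm_Gamma_ratio_le _ _ (by rw [er]; linarith) (by linarith)).trans ?_
    rw [er]
    refine (real_Gamma_ratio_le (α / 2) _ _ (by linarith) (by linarith) (by linarith)
      (by linarith)).trans ?_
    gcongr ?_ * ?_
    exact Real.rpow_le_rpow_of_nonpos (by linarith) (by linarith) (by linarith)
  · refine ⟨4 * ((1 + 1 / (α / 2)) * (1 / 2) ^ (-(2 - α))), by positivity, fun ξ hξ z hz => ?_⟩
    have hx := hre ξ z hz
    have hξ0 : 0 < ξ := by linarith
    rw [max_eq_right (by linarith)]
    have er : (((α / 2 : ℝ) : ℂ) + z).re = α / 2 + z.re := by simp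
    have hw : ((1 - α / 2 : ℝ) : ℂ) + z ≠ 0 := by
      intro h
      have := congrArg Complex.re h
      simp at this
      linarith
    have hg : Complex.Gamma (((1 - α / 2 : ℝ) : ℂ) + z) ≠ 0 :=
      Complex.Gamma_ne_zero_of_re_pos (by simp; linarith)
    have e : ((α / 2 : ℝ) + z) + ((2 - α : ℝ) : ℂ) = (((1 - α / 2 : ℝ) : ℂ) + z) + 1 := by
      push_cast; ring
    have key : Complex.Gamma ((α / 2 : ℝ) + z) / Complex.Gamma ((1 - α / 2 : ℝ) + z)
        = (((1 - α / 2 : ℝ) : ℂ) + z) * (Complex.Gamma ((α / 2 : ℝ) + z) /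
          Complex.Gamma (((α / 2 : ℝ) + z) + ((2 - α : ℝ) : ℂ))) := by
      rw [e, Complex.Gamma_add_one _ hw]
      rw [mul_div_assoc', mul_div_mul_left _ _ hw]
    rw [key, norm_mul]
    have hn : ‖((1 - α / 2 : ℝ) : ℂ) + z‖ ≤ 4 * ξ := by
      have e4 : ((1 - α / 2 : ℝ) : ℂ) + z = ((1 - α / 2 + ξ : ℝ) : ℂ) + (z - ξ) := by
        push_cast; ring
      rw [e4]
      refine (norm_add_le _ _).trans ?_
      rw [Complex.norm_real, Real.norm_eq_abs, abs_of_pos (by linarith)]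
      linarith
    have hq : ‖Complex.Gamma ((α / 2 : ℝ) + z) /
          Complex.Gamma (((α / 2 : ℝ) + z) + ((2 - α : ℝ) : ℂ))‖
        ≤ (1 + 1 / (α / 2)) * ((1 / 2) ^ (-(2 - α)) * ξ ^ (-(2 - α))) := by
      refine (norm_Gamma_ratio_le _ _ (by rw [er]; linarith) (by linarith)).trans ?_
      rw [er]
      refine (real_Gamma_ratio_le (α / 2) _ _ (by linarith) (by linarith) (by linarith)
        (by linarith)).trans ?_
      rw [← Real.mul_rpow (by norm_num) hξ0.le]
      gcongr ?_ * ?_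
      exact Real.rpow_le_rpow_of_nonpos (by linarith) (by linarith) (by linarith)
    have e5 : ξ ^ (α - 1) = ξ * ξ ^ (-(2 - α)) := by
      have : α - 1 = 1 + -(2 - α) := by ring
      rw [this, Real.rpow_add hξ0, Real.rpow_one]
    rw [e5]
    calc _ ≤ (4 * ξ) * ((1 + 1 / (α / 2)) * ((1 / 2) ^ (-(2 - α)) * ξ ^ (-(2 - α)))) := by
          gcongr
      _ = _ := by ring

/-- The holomorphic extension of the symbol. -/
noncomputable def FF (α : ℝ) (z : ℂ) : ℂ :=
  (VV α : ℂ) - AA α * (Complex.Gamma ((α / 2 : ℝ) + z) / Complex.Gamma ((1 - α / 2 : ℝ) + z))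

theorem FF_re (α x : ℝ) (hx : 0 < x) : LL α x = (FF α x).re := by
  unfold LL FF
  rw [abs_of_pos hx, ← Complex.ofReal_add, ← Complex.ofReal_add, Complex.Gamma_ofReal,
    Complex.Gamma_ofReal, ← Complex.ofReal_div, ← Complex.ofReal_mul, ← Complex.ofReal_sub,
    Complex.ofReal_re]

theorem diffAt_Gamma_of_re_pos (w : ℂ) (hw : 0 < w.re) : DifferentiableAt ℂ Complex.Gamma w := by
  apply Complex.differentiableAt_Gamma
  intro m h
  rw [h] at hw
  simp at hw
  have : (0:ℝ) ≤ m := m.cast_nonneg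
  linarith

theorem FF_diff (α : ℝ) (h0 : 0 < α) (h2 : α < 2) (z : ℂ) (hz : 0 < z.re) :
    DifferentiableAt ℂ (FF α) z := by
  have a1 : 0 < (((α / 2 : ℝ) : ℂ) + z).re := by
    rw [Complex.add_re, Complex.ofReal_re]; linarith
  have a2 : 0 < (((1 - α / 2 : ℝ) : ℂ) + z).re := by
    rw [Complex.add_re, Complex.ofReal_re]; linarith
  have d : ∀ c : ℂ, DifferentiableAt ℂ (fun z : ℂ => c + z) z := fun c => by fun_prop
  have b1 : DifferentiableAt ℂ (fun z : ℂ => Complex.Gamma (((α / 2 : ℝ) : ℂ) + z)) z :=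
    DifferentiableAt.comp z (diffAt_Gamma_of_re_pos _ a1) (d _)
  have b2 : DifferentiableAt ℂ (fun z : ℂ => Complex.Gamma (((1 - α / 2 : ℝ) : ℂ) + z)) z :=
    DifferentiableAt.comp z (diffAt_Gamma_of_re_pos _ a2) (d _)
  exact ((b1.div b2 (Complex.Gamma_ne_zero_of_re_pos a2)).const_mul _).const_sub _

theorem isOpen_rhp : IsOpen {z : ℂ | 0 < z.re} := isOpen_lt continuous_const Complex.continuous_re

theorem FF_an (α : ℝ) (h0 : 0 < α) (h2 : α < 2) : AnalyticOnNhd ℂ (FF α) {z : ℂ | 0 < z.re} :=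
  DifferentiableOn.analyticOnNhd
    (fun z hz => (FF_diff α h0 h2 z hz).differentiableWithinAt) isOpen_rhp

theorem iter_re (α : ℝ) (h0 : 0 < α) (h2 : α < 2) (n : ℕ) : ∀ x : ℝ, 0 < x →
    iteratedDeriv n (LL α) x = (iteratedDeriv n (FF α) x).re := by
  induction n with
  | zero => intro x hx; simpa using FF_re α x hx
  | succ n ih =>
    intro x hx
    rw [iteratedDeriv_succ, iteratedDeriv_succ]
    have han : AnalyticAt ℂ (iteratedDeriv n (FF α)) (x : ℂ) :=
      iteratedDeriv_eq_iterate (𝕜 := ℂ) (f := FF α) (n := n) ▸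
        AnalyticOnNhd.iterated_deriv (FF_an α h0 h2) n x (by simpa using hx)
    have hd := han.differentiableAt.hasDerivAt.real_of_complex
    refine (hd.congr_of_eventuallyEq ?_).deriv
    filter_upwards [lt_mem_nhds hx] with y hy using ih y hy

/-- `L_α` is a Fourier multiplier of order `max {0, α-1}`: it is smooth on `[1/2, ∞)`
and every derivative of order `β` is bounded by `C_β ξ^(max{0,α-1} - β)` there. -/
theorem L_is_multiplier_of_order_max (α : ℝ)
    (hα : α ∈ Set.Ioo (0 : ℝ) 1 ∪ Set.Ioo (1 : ℝ) 2) :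
    ContDiffOn ℝ (⊤ : ℕ∞) (LL α) (Set.Ici (1 / 2 : ℝ)) ∧
      ∀ β : ℕ, ∃ C : ℝ, 0 < C ∧
        ∀ ξ : ℝ, 1 / 2 ≤ ξ →
          |iteratedDerivWithin β (LL α) (Set.Ici (1 / 2 : ℝ)) ξ| ≤
            C * ξ ^ (max 0 (α - 1) - (β : ℝ)) := by
  have h0 : 0 < α := by rcases hα with h | h <;> linarith [h.1]
  have h2 : α < 2 := by rcases hα with h | h <;> linarith [h.2]
  have hcd : ∀ (n : WithTop ℕ∞) (x : ℝ), 0 < x → ContDiffAt ℝ n (LL α) x := by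
    intro n x hx
    have h : ContDiffAt ℂ n (FF α) (x : ℂ) := (FF_an α h0 h2 x (by simpa using hx)).contDiffAt
    refine h.real_of_complex.congr_of_eventuallyEq ?_
    filter_upwards [lt_mem_nhds hx] with y hy using FF_re α y hy
  refine ⟨fun x hx => (hcd _ x ?_).contDiffWithinAt, fun β => ?_⟩
  · have : (1 / 2 : ℝ) ≤ x := hx
    linarith
  obtain ⟨K, hK, hbd⟩ := G_bound α hα
  set m : ℝ := max 0 (α - 1) with hm
  have hm0 : 0 ≤ m := le_max_left _ _
  set M : ℝ := |VV α| * 2 ^ m + |AA α| * K + 1 with hM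
  have hMpos : 0 < M := by positivity
  refine ⟨β.factorial * M * 2 ^ β, by positivity, fun ξ hξ => ?_⟩
  have hξ0 : 0 < ξ := by linarith
  have hp : 0 < ξ ^ m := Real.rpow_pos_of_pos hξ0 _
  rw [iteratedDerivWithin_eq_iteratedDeriv (uniqueDiffOn_Ici _) (hcd _ ξ hξ0) hξ,
    iter_re α h0 h2 β ξ hξ0]
  refine (Complex.abs_re_le_norm _).trans ?_
  have hrp : ∀ z : ℂ, ‖z - ξ‖ ≤ ξ / 2 → 0 < z.re := by
    intro z h
    have := (abs_le.1 ((Complex.abs_re_le_norm (z - ξ)).trans h)).1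
    simp at this
    linarith
  have hC : ∀ z ∈ Metric.sphere (ξ : ℂ) (ξ / 2), ‖FF α z‖ ≤ M * ξ ^ m := by
    intro z hz
    rw [mem_sphere_iff_norm] at hz
    have hb := hbd ξ hξ z hz.le
    have h1 : (1 : ℝ) ≤ 2 ^ m * ξ ^ m := by
      rw [← Real.mul_rpow (by norm_num) hξ0.le]
      exact Real.one_le_rpow (by linarith) hm0
    unfold FF
    refine (norm_sub_le _ _).trans ?_
    rw [norm_mul, Complex.norm_real, Complex.norm_real, Real.norm_eq_abs, Real.norm_eq_abs]
    have h3 : |VV α| ≤ |VV α| * (2 ^ m * ξ ^ m) := le_mul_of_one_le_right (abs_nonneg _) h1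
    have h4 := mul_le_mul_of_nonneg_left hb (abs_nonneg (AA α))
    have h5 : M * ξ ^ m = |VV α| * (2 ^ m * ξ ^ m) + |AA α| * (K * ξ ^ m) + ξ ^ m := by
      rw [hM]; ring
    linarith
  have hd : DiffContOnCl ℂ (FF α) (Metric.ball (ξ : ℂ) (ξ / 2)) := by
    apply DifferentiableOn.diffContOnCl
    intro z hz
    have hz' := Metric.closure_ball_subset_closedBall hz
    rw [mem_closedBall_iff_norm] at hz'
    exact (FF_diff α h0 h2 z (hrp z hz')).differentiableWithinAt
  refine (Complex.norm_iteratedDeriv_le_of_forall_mem_sphere_norm_le β (by linarith) hd hC).trans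
    (le_of_eq ?_)
  rw [Real.rpow_sub hξ0, Real.rpow_natCast, div_pow]
  field_simp
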